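/- If u ∈ E solves the fractional Ginzburg-Landau equation (-Δ)^{α/2}u = u(1 − |u|²) in ℝⁿ and satisfies ∫_{ℝⁿ}(1 − |u|²)² dx < ∞, then |u(x)| ≤ 1 for all x ∈ ℝⁿ. -/

import Mathlib

open MeasureTheory Filter

/-- The fractional Laplacian `(-Δ)^{α/2}` with normalizing constant `C`,
defined as the principal-value singular integral. -/
noncomputable def fracLap (n : ℕ) (α C : ℝ)
    (u : EuclideanSpace ℝ (Fin n) → ℝ) (x : EuclideanSpace ℝ (Fin n)) : ℝ :=
  C * limUnder (nhdsWithin (0 : ℝ) (Set.Ioi 0)) (fun ε : ℝ =>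
    ∫ y in {y : EuclideanSpace ℝ (Fin n) | ε ≤ dist x y},
      (u x - u y) / dist x y ^ ((n : ℝ) + α))

/-- Membership in `E = C^{1,1}_loc(ℝⁿ) ∩ L_α`. -/
def MemE (n : ℕ) (α : ℝ) (u : EuclideanSpace ℝ (Fin n) → ℝ) : Prop :=
  Differentiable ℝ u ∧
  (∀ R : ℝ, ∃ K : NNReal, LipschitzOnWith K (fderiv ℝ u) (Metric.ball 0 R)) ∧
  Integrable (fun x : EuclideanSpace ℝ (Fin n) => |u x| / (1 + ‖x‖ ^ ((n : ℝ) + α)))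

open Set Metric Topology

/-- Euclidean space `ℝⁿ`. -/
abbrev Euc (n : ℕ) := EuclideanSpace ℝ (Fin n)

/-- The potential `(1 - |u|²)²`. -/
noncomputable def potential {n : ℕ} (u : Euc n → ℝ) (x : Euc n) : ℝ := (1 - |u x| ^ 2) ^ 2

/-- The truncated singular integral whose limit as `ε → 0` is the fractional Laplacian. -/
noncomputable def truncLap {n : ℕ} (s : ℝ) (u : Euc n → ℝ) (x : Euc n) (ε : ℝ) : ℝ :=
  ∫ z in {z : Euc n | ε ≤ ‖z‖}, (u x - u (x + z)) / ‖z‖ ^ s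

/-- The singular integrand corrected by a linear term inside the ball of radius `r`. -/
noncomputable def corrected {n : ℕ} (s : ℝ) (u : Euc n → ℝ) (x : Euc n) (p : Euc n →L[ℝ] ℝ)
    (r : ℝ) (z : Euc n) : ℝ :=
  (u x - u (x + z)) / ‖z‖ ^ s + (ball (0 : Euc n) r).indicator (fun z => p z / ‖z‖ ^ s) z

/-- The integral of `(1 + ‖z‖)⁻ˢ`. -/
noncomputable def tailMass (n : ℕ) (s : ℝ) : ℝ := ∫ z : Euc n, (1 + ‖z‖) ^ (-s)

/-- The integral of `‖z‖^(2-s)` over the unit ball. -/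
noncomputable def coreMass (n : ℕ) (s : ℝ) : ℝ := ∫ z in ball (0 : Euc n) 1, ‖z‖ ^ 2 / ‖z‖ ^ s

section Preliminaries

variable {n : ℕ} {s : ℝ} {u : Euc n → ℝ}

lemma potential_nonneg (x : Euc n) : 0 ≤ potential u x := sq_nonneg _

lemma potential_neg : potential (-u) = potential u := by
  funext x; simp [potential]

lemma sub_one_le_potential (x : Euc n) : |u x| - 1 ≤ 1 + potential u x := by
  unfold potential
  nlinarith [abs_nonneg (u x), sq_nonneg (|u x| ^ 2 - 3 / 2), sq_nonneg (|u x| - 1)]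

lemma measurableSet_le_norm (ε : ℝ) : MeasurableSet {z : Euc n | ε ≤ ‖z‖} :=
  measurableSet_le measurable_const measurable_norm

lemma integrable_tail (hs : (n : ℝ) < s) : Integrable (fun z : Euc n => (1 + ‖z‖) ^ (-s)) :=
  integrable_one_add_norm (by simpa using hs)

lemma integrableOn_core (hn : 1 ≤ n) (hs : s < n + 2) :
    IntegrableOn (fun z : Euc n => ‖z‖ ^ 2 / ‖z‖ ^ s) (ball 0 1) := by
  have : Nonempty (Fin n) := ⟨⟨0, hn⟩⟩
  refine (integrableOn_fun_norm_addHaar (E := Euc n) volume (f := fun t => t ^ 2 / t ^ s)).2 ?_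
  have h : IntegrableOn (fun t : ℝ => t ^ ((n : ℝ) + 1 - s)) (Ioo 0 1) :=
    (intervalIntegral.integrableOn_Ioo_rpow_iff one_pos).2 (by linarith)
  refine h.congr_fun (fun t ht => ?_) measurableSet_Ioo
  have ht0 : 0 < t := ht.1
  simp only [finrank_euclideanSpace, Fintype.card_fin, smul_eq_mul]
  rw [Real.rpow_sub ht0, ← Nat.cast_add_one, Real.rpow_natCast, mul_div_assoc', ← pow_add]
  congr 2
  omega

lemma coreMass_nonneg : 0 ≤ coreMass n s :=
  integral_nonneg fun z => by positivity

lemma tailMass_nonneg : 0 ≤ tailMass n s :=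
  integral_nonneg fun z => by positivity

lemma inv_rpow_norm_le (hs : 0 ≤ s) {r : ℝ} (hr : 0 < r) (hr1 : r ≤ 1) {z : Euc n}
    (hz : r ≤ ‖z‖) : 1 / ‖z‖ ^ s ≤ (2 / r) ^ s * (1 + ‖z‖) ^ (-s) := by
  have hz0 : 0 < ‖z‖ := hr.trans_le hz
  rw [Real.rpow_neg (by positivity), ← div_eq_mul_inv, ← Real.div_rpow (by positivity)
    (by positivity), one_div, ← Real.inv_rpow hz0.le]
  refine Real.rpow_le_rpow (by positivity) ?_ hs
  rw [inv_eq_one_div, div_div, div_le_div_iff₀ hz0 (by positivity)]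
  nlinarith

/-- An integrable majorant of `(a + b (1 - |u|²)²) / ‖z‖ˢ` away from the origin. -/
noncomputable def tailMajorant (s : ℝ) (u : Euc n → ℝ) (x : Euc n) (r a b : ℝ) (z : Euc n) : ℝ :=
  (2 / r) ^ s * (a * (1 + ‖z‖) ^ (-s) + b * potential u (x + z))

lemma le_tailMajorant (hs : 0 ≤ s) {r a b t : ℝ} (hr : 0 < r) (hr1 : r ≤ 1) (ha : 0 ≤ a)
    (hb : 0 ≤ b) {x z : Euc n} (hz : r ≤ ‖z‖) (ht : t ≤ a + b * potential u (x + z)) :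
    t / ‖z‖ ^ s ≤ tailMajorant s u x r a b z := by
  have h := inv_rpow_norm_le hs hr hr1 hz
  have hg := potential_nonneg (u := u) (x + z)
  have h1 : (1 + ‖z‖) ^ (-s) ≤ 1 :=
    Real.rpow_le_one_of_one_le_of_nonpos (by linarith [norm_nonneg z]) (by linarith)
  calc t / ‖z‖ ^ s ≤ (a + b * potential u (x + z)) * (1 / ‖z‖ ^ s) := by
        rw [mul_one_div]; gcongr
    _ ≤ (a + b * potential u (x + z)) * ((2 / r) ^ s * (1 + ‖z‖) ^ (-s)) := by gcongr
    _ = (2 / r) ^ s * (a * (1 + ‖z‖) ^ (-s) + b * potential u (x + z) * (1 + ‖z‖) ^ (-s)) := by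
        ring
    _ ≤ (2 / r) ^ s * (a * (1 + ‖z‖) ^ (-s) + b * potential u (x + z) * 1) := by gcongr
    _ = tailMajorant s u x r a b z := by rw [mul_one, tailMajorant]

lemma tailMajorant_nonneg {r a b : ℝ} (hr : 0 < r) (ha : 0 ≤ a) (hb : 0 ≤ b) (x z : Euc n) :
    0 ≤ tailMajorant s u x r a b z := by
  have := potential_nonneg (u := u) (x + z)
  unfold tailMajorant
  positivity

variable (hs : (n : ℝ) < s) (hint : Integrable (potential u))
include hs hint

lemma integrable_tailMajorant (x : Euc n) (r a b : ℝ) :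
    Integrable (tailMajorant s u x r a b) :=
  (((integrable_tail hs).const_mul a).add ((hint.comp_add_left x).const_mul b)).const_mul _

lemma integral_tailMajorant (x : Euc n) (r a b : ℝ) :
    ∫ z, tailMajorant s u x r a b z =
      (2 / r) ^ s * (a * tailMass n s + b * ∫ y, potential u y) := by
  unfold tailMajorant
  rw [integral_const_mul, integral_add ((integrable_tail hs).const_mul a)
    ((hint.comp_add_left x).const_mul b), integral_const_mul, integral_const_mul,
    integral_add_left_eq_self (potential u) x, tailMass]

variable (hc : Continuous u)
include hc

lemma integrableOn_quotient (x : Euc n) {ε : ℝ} (hε : 0 < ε) (hε1 : ε ≤ 1) :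
    IntegrableOn (fun z => (u x - u (x + z)) / ‖z‖ ^ s) {z | ε ≤ ‖z‖} := by
  have hs0 : 0 ≤ s := (Nat.cast_nonneg n).trans hs.le
  refine Integrable.mono' (integrable_tailMajorant hs hint x ε (|u x| + 2) 1).integrableOn
    (Measurable.aestronglyMeasurable (by fun_prop)) ?_
  refine (ae_restrict_mem (measurableSet_le_norm ε)).mono fun z hz => ?_
  rw [norm_div, Real.norm_of_nonneg (by positivity : 0 ≤ ‖z‖ ^ s)]
  refine le_tailMajorant hs0 hε hε1 (by positivity) zero_le_one hz ?_
  have := sub_one_le_potential (u := u) (x + z)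
  have := abs_sub (u x) (u (x + z))
  rw [Real.norm_eq_abs]
  linarith

omit hint hc in
lemma integrableOn_linear (p : Euc n →L[ℝ] ℝ) (r : ℝ) {ε : ℝ} (hε : 0 < ε) :
    IntegrableOn ((ball (0 : Euc n) r).indicator (fun z => p z / ‖z‖ ^ s)) {z | ε ≤ ‖z‖} := by
  have hs0 : 0 ≤ s := (Nat.cast_nonneg n).trans hs.le
  refine Integrable.mono' (g := (ball (0 : Euc n) r).indicator (fun _ => ‖p‖ * |r| / ε ^ s)) ?_
    (Measurable.aestronglyMeasurable (Measurable.indicator (by fun_prop) measurableSet_ball)) ?_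
  · exact ((integrableOn_const (by simp [measure_ball_lt_top.ne])).integrable_indicator
      measurableSet_ball).integrableOn
  · refine (ae_restrict_mem (measurableSet_le_norm ε)).mono fun z hz => ?_
    rw [norm_indicator_eq_indicator_norm]
    by_cases hzr : z ∈ ball (0 : Euc n) r
    · rw [indicator_of_mem hzr, indicator_of_mem hzr, norm_div,
        Real.norm_of_nonneg (by positivity : 0 ≤ ‖z‖ ^ s)]
      have h1 : ‖z‖ ≤ |r| := (mem_ball_zero_iff.1 hzr).le.trans (le_abs_self r)
      have h2 : ε ≤ ‖z‖ := hz
      have h3 := p.le_opNorm z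
      gcongr
      exact h3.trans (by gcongr)
    · rw [indicator_of_notMem hzr, indicator_of_notMem hzr]

omit hs hint hc in
lemma integral_linear_eq_zero (p : Euc n →L[ℝ] ℝ) (r ε : ℝ) :
    ∫ z in {z : Euc n | ε ≤ ‖z‖}, (ball (0 : Euc n) r).indicator (fun z => p z / ‖z‖ ^ s) z = 0 := by
  rw [← integral_indicator (measurableSet_le_norm ε)]
  set f : Euc n → ℝ := {z : Euc n | ε ≤ ‖z‖}.indicator
    ((ball (0 : Euc n) r).indicator (fun z => p z / ‖z‖ ^ s)) with hf
  have hodd : ∀ z, f (-z) = -f z := fun z => by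
    simp only [hf, indicator, mem_ofPred_eq, norm_neg, mem_ball_zero_iff, map_neg]
    split_ifs <;> simp [neg_div]
  have h := integral_neg_eq_self f volume
  simp only [hodd, integral_neg] at h
  linarith

lemma integrableOn_corrected (x : Euc n) (p : Euc n →L[ℝ] ℝ) (r : ℝ) {ε : ℝ} (hε : 0 < ε)
    (hε1 : ε ≤ 1) : IntegrableOn (corrected s u x p r) {z | ε ≤ ‖z‖} :=
  (integrableOn_quotient hs hint hc x hε hε1).add (integrableOn_linear hs p r hε)

lemma truncLap_eq (x : Euc n) (p : Euc n →L[ℝ] ℝ) (r : ℝ) {ε : ℝ} (hε : 0 < ε) (hε1 : ε ≤ 1) :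
    truncLap s u x ε = ∫ z in {z : Euc n | ε ≤ ‖z‖}, corrected s u x p r z := by
  unfold corrected
  rw [integral_add (integrableOn_quotient hs hint hc x hε hε1) (integrableOn_linear hs p r hε),
    integral_linear_eq_zero, add_zero, truncLap]

/-- The fractional Laplacian is bounded below at a point where the function is touched from above
by a paraboloid. -/
lemma le_of_touching (hn : 1 ≤ n) (hs2 : s < n + 2) {x : Euc n} {p : Euc n →L[ℝ] ℝ}
    {r K a b L : ℝ} (hr : 0 < r) (hr1 : r ≤ 1) (hK : 0 ≤ K) (ha : 0 ≤ a) (hb : 0 ≤ b)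
    (hquad : ∀ z, ‖z‖ < r → u (x + z) ≤ u x + p z + K * ‖z‖ ^ 2)
    (htail : ∀ z, r ≤ ‖z‖ → u (x + z) - u x ≤ a + b * potential u (x + z))
    (hlim : Tendsto (truncLap s u x) (𝓝[>] 0) (𝓝 L)) :
    -(K * coreMass n s + (2 / r) ^ s * (a * tailMass n s + b * ∫ y, potential u y)) ≤ L := by
  have hs0 : 0 ≤ s := (Nat.cast_nonneg n).trans hs.le
  set B : Euc n → ℝ := fun z => K * (ball (0 : Euc n) 1).indicator (fun z => ‖z‖ ^ 2 / ‖z‖ ^ s) z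
    + tailMajorant s u x r a b z with hB
  have hcore := (integrableOn_core hn hs2).integrable_indicator (measurableSet_ball)
  have hBint : Integrable B := (hcore.const_mul K).add (integrable_tailMajorant hs hint x r a b)
  have hcore0 : ∀ z : Euc n, 0 ≤ (ball (0 : Euc n) 1).indicator (fun z => ‖z‖ ^ 2 / ‖z‖ ^ s) z :=
    fun z => indicator_nonneg (fun z _ => by positivity) z
  have hB0 : ∀ z, 0 ≤ B z := fun z =>
    add_nonneg (mul_nonneg hK (hcore0 z)) (tailMajorant_nonneg hr ha hb x z)
  have hBval : ∫ z, B z =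
      K * coreMass n s + (2 / r) ^ s * (a * tailMass n s + b * ∫ y, potential u y) := by
    rw [hB, integral_add (hcore.const_mul K) (integrable_tailMajorant hs hint x r a b),
      integral_const_mul, integral_indicator measurableSet_ball,
      integral_tailMajorant hs hint, coreMass]
  have hpt : ∀ z, -B z ≤ corrected s u x p r z := fun z => by
    by_cases hz : ‖z‖ < r
    · have h1 : z ∈ ball (0 : Euc n) r := by simpa using hz
      have h2 : z ∈ ball (0 : Euc n) 1 := by simpa using hz.trans_le hr1
      have h3 := tailMajorant_nonneg (s := s) (u := u) hr ha hb x z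
      simp only [hB, corrected, indicator_of_mem h1, indicator_of_mem h2]
      have h4 : -(K * (‖z‖ ^ 2 / ‖z‖ ^ s)) ≤ (u x - u (x + z)) / ‖z‖ ^ s + p z / ‖z‖ ^ s := by
        rw [← add_div, ← mul_div_assoc, ← neg_div]
        have := hquad z hz
        gcongr
        linarith
      linarith
    · have h1 : z ∉ ball (0 : Euc n) r := by simpa using hz
      have h2 := le_tailMajorant hs0 hr hr1 ha hb (not_lt.1 hz) (htail z (not_lt.1 hz))
      have h3 := mul_nonneg hK (hcore0 z)
      simp only [hB, corrected, indicator_of_notMem h1]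
      rw [← neg_sub, neg_div] at h2
      linarith
  rw [← hBval]
  refine ge_of_tendsto hlim ?_
  filter_upwards [Ioo_mem_nhdsGT (zero_lt_one (α := ℝ))] with ε hε
  rw [truncLap_eq hs hint hc x p r hε.1 hε.2.le]
  calc -∫ z, B z ≤ -∫ z in {z : Euc n | ε ≤ ‖z‖}, B z :=
        neg_le_neg (setIntegral_le_integral hBint (Eventually.of_forall hB0))
    _ = ∫ z in {z : Euc n | ε ≤ ‖z‖}, -B z := (integral_neg _).symm
    _ ≤ _ := integral_mono hBint.neg.integrableOn
        (integrableOn_corrected hs hint hc x p r hε.1 hε.2.le) hpt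

/-- The principal value exists for locally `C^{1,1}` functions. -/
lemma exists_tendsto_truncLap (hn : 1 ≤ n) (hs2 : s < n + 2) (hd : Differentiable ℝ u)
    (hL : ∀ R : ℝ, ∃ K : NNReal, LipschitzOnWith K (fderiv ℝ u) (ball 0 R)) (x : Euc n) :
    ∃ L, Tendsto (truncLap s u x) (𝓝[>] 0) (𝓝 L) := by
  have hs0 : 0 ≤ s := (Nat.cast_nonneg n).trans hs.le
  obtain ⟨K, hK⟩ := hL (‖x‖ + 1)
  have hquad : ∀ z, ‖z‖ < 1 → |u x - u (x + z) + fderiv ℝ u x z| ≤ K * ‖z‖ ^ 2 := fun z hz => by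
    have hsub : closedBall x ‖z‖ ⊆ ball 0 (‖x‖ + 1) := fun y hy => by
      rw [mem_closedBall, dist_eq_norm] at hy
      have := norm_add_le (y - x) x
      rw [sub_add_cancel] at this
      rw [mem_ball_zero_iff]
      linarith
    have hx : x ∈ closedBall x ‖z‖ := mem_closedBall_self (norm_nonneg z)
    have h := (convex_closedBall x ‖z‖).norm_image_sub_le_of_norm_fderiv_le'
      (f := u) (𝕜 := ℝ) (φ := fderiv ℝ u x) (C := K * ‖z‖) (y := x + z) (fun y _ => hd y)
      (fun y hy => by
        refine (hK.norm_sub_le (hsub hy) (hsub hx)).trans ?_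
        rw [mem_closedBall, dist_eq_norm] at hy
        gcongr) hx (by simp)
    rw [add_sub_cancel_left, Real.norm_eq_abs, ← abs_neg] at h
    calc _ = |-(u (x + z) - u x - fderiv ℝ u x z)| := by congr 1; ring
      _ ≤ _ := by rw [sq, ← mul_assoc]; exact h
  set h := corrected s u x (fderiv ℝ u x) 1 with hh
  have hball : IntegrableOn h (ball 0 1) := by
    refine Integrable.mono' ((integrableOn_core hn hs2).const_mul (K : ℝ)) ?_ ?_
    · refine Measurable.aestronglyMeasurable ?_
      exact Measurable.add (by fun_prop) (Measurable.indicator (by fun_prop) measurableSet_ball)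
    · refine (ae_restrict_mem measurableSet_ball).mono fun z hz => ?_
      simp only [hh, corrected, indicator_of_mem hz]
      rw [← add_div, norm_div, Real.norm_of_nonneg (by positivity : 0 ≤ ‖z‖ ^ s),
        Real.norm_eq_abs, ← mul_div_assoc]
      have := hquad z (by simpa using hz)
      gcongr
  have hint' : Integrable h := by
    rw [← integrableOn_univ]
    refine (hball.union (integrableOn_corrected hs hint hc x (fderiv ℝ u x) 1 one_pos
      le_rfl)).mono_set fun z _ => ?_
    rcases lt_or_ge ‖z‖ 1 with hz | hz
    · exact Or.inl (by simpa using hz)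
    · exact Or.inr hz
  refine ⟨∫ z, h z, ?_⟩
  have key : Tendsto (fun ε : ℝ => ∫ z, {z : Euc n | ε ≤ ‖z‖}.indicator h z) (𝓝[>] 0)
      (𝓝 (∫ z, h z)) := by
    refine tendsto_integral_filter_of_dominated_convergence (fun z => ‖h z‖)
      (Eventually.of_forall fun ε =>
        (hint'.indicator (measurableSet_le_norm ε)).aestronglyMeasurable)
      (Eventually.of_forall fun ε => Eventually.of_forall fun z => norm_indicator_le_norm_self _ _)
      hint'.norm (Eventually.of_forall fun z => ?_)
    rcases eq_or_ne z 0 with rfl | hz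
    · have : h 0 = 0 := by simp [hh, corrected]
      have h0 : (fun ε : ℝ => {z : Euc n | ε ≤ ‖z‖}.indicator h 0) = fun _ => 0 := by
        funext ε; simp [indicator, this]
      rw [h0, this]
      exact tendsto_const_nhds
    · refine tendsto_const_nhds.congr' ?_
      filter_upwards [Ioo_mem_nhdsGT (norm_pos_iff.2 hz)] with ε hε
      rw [indicator_of_mem (show z ∈ {z : Euc n | ε ≤ ‖z‖} from hε.2.le)]
  refine key.congr' ?_
  filter_upwards [Ioo_mem_nhdsGT (zero_lt_one (α := ℝ))] with ε hε
  rw [truncLap_eq hs hint hc x (fderiv ℝ u x) 1 hε.1 hε.2.le,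
    integral_indicator (measurableSet_le_norm ε)]

end Preliminaries

section MaximumPrinciple

variable {n : ℕ} {s C : ℝ} {u : Euc n → ℝ}

/-- The fractional Ginzburg-Landau equation, including convergence of the principal value. -/
def SolvesGL (s C : ℝ) (u : Euc n → ℝ) : Prop :=
  ∀ x, ∃ L, Tendsto (truncLap s u x) (𝓝[>] 0) (𝓝 L) ∧ C * L = u x * (1 - u x ^ 2)

lemma SolvesGL.neg (h : SolvesGL s C u) : SolvesGL s C (-u) := fun x => by
  obtain ⟨L, hL, hLu⟩ := h x
  refine ⟨-L, hL.neg.congr fun ε => ?_, ?_⟩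
  · rw [truncLap, truncLap, ← integral_neg]
    congr 1
    funext z
    simp only [Pi.neg_apply]
    ring
  · simp only [Pi.neg_apply]
    linear_combination -hLu

lemma setIntegral_dist_eq_truncLap (s : ℝ) (u : Euc n → ℝ) (x : Euc n) (ε : ℝ) :
    ∫ y in {y : Euc n | ε ≤ dist x y}, (u x - u y) / dist x y ^ s = truncLap s u x ε := by
  rw [truncLap, ← integral_indicator (measurableSet_le_norm ε),
    ← integral_indicator (measurableSet_le measurable_const (by fun_prop)),
    ← integral_add_left_eq_self _ x]
  congr 1
  funext z
  simp [indicator, dist_eq_norm]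

lemma fracLap_eq_of_tendsto {α L : ℝ} {x : Euc n}
    (h : Tendsto (truncLap ((n : ℝ) + α) u x) (𝓝[>] 0) (𝓝 L)) : fracLap n α C u x = C * L := by
  simp only [fracLap, setIntegral_dist_eq_truncLap]
  rw [h.limUnder_eq]

/-- A near-maximum can be moved to a nearby point where the function is touched from above by a
paraboloid. -/
lemma exists_touching_paraboloid (hc : Continuous u) {x₀ : Euc n} {r K : ℝ} (hr : 0 < r)
    (hK : 0 ≤ K) (hbd : ∀ y ∈ closedBall x₀ (2 * r), u y ≤ u x₀ + K * r ^ 2) :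
    ∃ x, u x₀ ≤ u x ∧ ∃ p : Euc n →L[ℝ] ℝ,
      ∀ z, ‖z‖ < r → u (x + z) ≤ u x + p z + K * ‖z‖ ^ 2 := by
  obtain ⟨x, hx, hmax⟩ := (isCompact_closedBall x₀ r).exists_isMaxOn
    ⟨x₀, mem_closedBall_self hr.le⟩
    (f := fun y => u y - K * ‖y - x₀‖ ^ 2) (by fun_prop)
  have h0 : u x₀ ≤ u x - K * ‖x - x₀‖ ^ 2 := by
    simpa using hmax (mem_closedBall_self hr.le)
  refine ⟨x, by nlinarith [sq_nonneg ‖x - x₀‖], (2 * K) • innerSL ℝ (x - x₀), fun z hz => ?_⟩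
  have hexp : ‖x + z - x₀‖ ^ 2 = ‖x - x₀‖ ^ 2 + 2 * inner ℝ (x - x₀) z + ‖z‖ ^ 2 := by
    rw [← norm_add_sq_real, sub_add_eq_add_sub]
  have hv : u (x + z) - K * ‖x + z - x₀‖ ^ 2 ≤ u x - K * ‖x - x₀‖ ^ 2 := by
    by_cases hin : x + z ∈ closedBall x₀ r
    · exact hmax hin
    · have h1 : r < ‖x + z - x₀‖ := by simpa [dist_eq_norm] using hin
      have h2 : x + z ∈ closedBall x₀ (2 * r) := by
        rw [mem_closedBall, dist_eq_norm] at hx ⊢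
        have := norm_add_le (x - x₀) z
        rw [sub_add_eq_add_sub] at this
        linarith
      have h3 : K * r ^ 2 ≤ K * ‖x + z - x₀‖ ^ 2 := by gcongr
      linarith [hbd _ h2]
  simp only [smul_apply, innerSL_apply_apply, smul_eq_mul]
  rw [hexp] at hv
  linarith

variable (hn : 1 ≤ n) (hs : (n : ℝ) < s) (hs2 : s < n + 2) (hC : 0 < C) (hc : Continuous u)
  (hint : Integrable (potential u)) (hu : SolvesGL s C u)
include hn hs hs2 hC hc hint hu

/-- Upper bound for the reaction term at a point where `u` is comparable to its nearby maximum. -/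
lemma reaction_le {x₀ : Euc n} {r K a b : ℝ} (hr : 0 < r) (hr1 : r ≤ 1) (hK : 0 ≤ K)
    (ha : 0 ≤ a) (hb : 0 ≤ b) (h1 : 1 ≤ u x₀)
    (hbd : ∀ y ∈ closedBall x₀ (2 * r), u y ≤ u x₀ + K * r ^ 2)
    (htail : ∀ y, u y - u x₀ ≤ a + b * potential u y) :
    u x₀ * (u x₀ ^ 2 - 1) ≤
      C * (K * coreMass n s + (2 / r) ^ s * (a * tailMass n s + b * ∫ y, potential u y)) := by
  obtain ⟨x, hx, p, hp⟩ := exists_touching_paraboloid hc hr hK hbd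
  obtain ⟨L, hL, hLu⟩ := hu x
  have h := le_of_touching hs hint hc hn hs2 hr hr1 hK ha hb hp
    (fun z _ => by linarith [htail (x + z)]) hL
  calc u x₀ * (u x₀ ^ 2 - 1) ≤ u x * (u x ^ 2 - 1) := by
        have : 0 ≤ u x₀ ^ 2 - 1 := by nlinarith
        gcongr
        linarith
    _ = C * -L := by linear_combination hLu
    _ ≤ _ := by gcongr; linarith

/-- A Keller-Osserman type estimate: entire solutions are bounded above. -/
lemma exists_upper_bound : ∃ S, ∀ x, u x ≤ S := by
  have hc1 := coreMass_nonneg (n := n) (s := s)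
  have hI := tailMass_nonneg (n := n) (s := s)
  have hA : 0 ≤ ∫ y, potential u y := integral_nonneg potential_nonneg
  set β : ℕ := n + 2 with hβ
  set D : ℝ := C * (2 ^ β * coreMass n s + (tailMass n s + ∫ y, potential u y)) with hD
  have hD0 : 0 ≤ D := by positivity
  refine ⟨1 + D * 8 ^ β, fun x₀ => ?_⟩
  by_contra! hcon
  have hDβ : 0 ≤ D * 8 ^ β := by positivity
  have hx₀ : 1 < u x₀ := by linarith
  obtain ⟨x, hx, hmax⟩ := (isCompact_closedBall x₀ 1).exists_isMaxOn
    ⟨x₀, mem_closedBall_self zero_le_one⟩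
    (f := fun y => (1 - ‖y - x₀‖) ^ β * u y) (by fun_prop)
  have h0 : u x₀ ≤ (1 - ‖x - x₀‖) ^ β * u x := by
    simpa using hmax (mem_closedBall_self zero_le_one)
  rw [mem_closedBall, dist_eq_norm] at hx
  set d : ℝ := 1 - ‖x - x₀‖ with hd
  have hd1 : d ≤ 1 := by linarith [norm_nonneg (x - x₀)]
  have hd0 : 0 < d := by
    refine lt_of_le_of_ne (by linarith) fun h => ?_
    rw [← h, zero_pow (by omega)] at h0
    linarith
  have hdβ1 : d ^ β ≤ 1 := pow_le_one₀ hd0.le hd1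
  have hdβ0 : 0 < d ^ β := by positivity
  have hM0 : 0 < u x := by
    by_contra! h
    nlinarith
  have hM : u x₀ ≤ u x := by nlinarith
  have hbd : ∀ y ∈ closedBall x (2 * (d / 4)),
      u y ≤ u x + 2 ^ β * u x / (d / 4) ^ 2 * (d / 4) ^ 2 := fun y hy => by
    rw [div_mul_cancel₀ _ (by positivity)]
    rw [mem_closedBall, dist_eq_norm] at hy
    have htri := norm_add_le (y - x) (x - x₀)
    rw [sub_add_sub_cancel] at htri
    have hy1 : d / 2 ≤ 1 - ‖y - x₀‖ := by linarith
    suffices u y ≤ 2 ^ β * u x by linarith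
    rcases le_or_gt (u y) 0 with h | h
    · exact h.trans (by positivity)
    · have h2 : (1 - ‖y - x₀‖) ^ β * u y ≤ d ^ β * u x :=
        hmax (by rw [mem_closedBall, dist_eq_norm]; linarith)
      have h3 : (d / 2) ^ β * u y ≤ (1 - ‖y - x₀‖) ^ β * u y := by gcongr
      rw [div_pow] at h3
      have h4 : d ^ β * u y ≤ d ^ β * (2 ^ β * u x) := by
        have := mul_le_mul_of_nonneg_left (h3.trans h2) (by positivity : (0 : ℝ) ≤ 2 ^ β)
        calc d ^ β * u y = 2 ^ β * (d ^ β / 2 ^ β * u y) := by field_simp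
          _ ≤ _ := this
          _ = _ := by ring
      exact le_of_mul_le_mul_left h4 hdβ0
  have hre := reaction_le hn hs hs2 hC hc hint hu (x₀ := x) (r := d / 4)
    (K := 2 ^ β * u x / (d / 4) ^ 2) (a := 1) (b := 1) (by positivity) (by linarith)
    (by positivity) zero_le_one zero_le_one (by linarith) hbd
    (fun y => by linarith [sub_one_le_potential (u := u) y, le_abs_self (u y)])
  have hq : 1 ≤ 8 / d := by rw [le_div_iff₀ hd0]; linarith
  have hpow1 : (2 / (d / 4)) ^ s ≤ (8 / d) ^ β := by
    rw [show 2 / (d / 4) = 8 / d by field_simp; norm_num, ← Real.rpow_natCast]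
    refine Real.rpow_le_rpow_of_exponent_le hq ?_
    rw [hβ]; push_cast; exact hs2.le
  have hpow2 : 1 / (d / 4) ^ 2 ≤ (8 / d) ^ β := by
    refine le_trans ?_ (pow_le_pow_right₀ hq (by omega : 2 ≤ β))
    rw [div_pow, div_pow, one_div_div]
    gcongr
    norm_num
  have hre2 : u x * (u x ^ 2 - 1) ≤ u x * (D * (8 / d) ^ β) := by
    refine hre.trans ?_
    have hx1 : 1 ≤ u x := by linarith
    calc _ = C * (2 ^ β * u x * coreMass n s * (1 / (d / 4) ^ 2)
          + 1 * (2 / (d / 4)) ^ s * (tailMass n s + ∫ y, potential u y)) := by ring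
      _ ≤ C * (2 ^ β * u x * coreMass n s * (8 / d) ^ β
          + u x * (8 / d) ^ β * (tailMass n s + ∫ y, potential u y)) := by gcongr
      _ = _ := by rw [hD]; ring
  have hsq : d ^ β * u x ^ 2 ≤ d ^ β + D * 8 ^ β := by
    have h := le_of_mul_le_mul_left hre2 hM0
    have h' := mul_le_mul_of_nonneg_left h hdβ0.le
    have e : d ^ β * (D * (8 / d) ^ β) = D * 8 ^ β := by rw [div_pow]; field_simp
    linarith
  have hfin : u x₀ ^ 2 ≤ 1 + D * 8 ^ β := by
    calc u x₀ ^ 2 ≤ (d ^ β * u x) ^ 2 := by gcongr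
      _ = d ^ β * (d ^ β * u x ^ 2) := by ring
      _ ≤ 1 * (d ^ β * u x ^ 2) := by gcongr
      _ ≤ _ := by linarith
  nlinarith

lemma le_one_of_solvesGL (x : Euc n) : u x ≤ 1 := by
  have hI := tailMass_nonneg (n := n) (s := s)
  have hc1 := coreMass_nonneg (n := n) (s := s)
  obtain ⟨S₀, hS₀⟩ := exists_upper_bound hn hs hs2 hC hc hint hu
  have hbdd : BddAbove (range u) := ⟨S₀, by rintro _ ⟨y, rfl⟩; exact hS₀ y⟩
  set S := ⨆ y, u y with hS
  have hle : ∀ y, u y ≤ S := le_ciSup hbdd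
  refine (hle x).trans ?_
  by_contra! hS1
  set D : ℝ := C * (coreMass n s + (2 / 1) ^ s * tailMass n s) with hD
  have hD0 : 0 ≤ D := by positivity
  set η : ℝ := (S - 1) / 2 with hη
  have hη0 : 0 < η := by linarith
  set δ : ℝ := min η (η / (D + 1)) with hδ
  have hδ0 : 0 < δ := lt_min hη0 (by positivity)
  have hδη : δ ≤ η := min_le_left _ _
  have hδD : δ * (D + 1) ≤ η := (le_div_iff₀ (by positivity)).1 (min_le_right _ _)
  obtain ⟨x₀, hx₀⟩ := exists_lt_of_lt_ciSup (show S - δ < ⨆ y, u y by linarith)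
  have hre := reaction_le hn hs hs2 hC hc hint hu (x₀ := x₀) (r := 1) (K := δ) (a := δ) (b := 0)
    one_pos le_rfl hδ0.le hδ0.le le_rfl (by linarith)
    (fun y _ => by linarith [hle y]) (fun y => by linarith [hle y])
  have hre2 : u x₀ * (u x₀ ^ 2 - 1) ≤ δ * D := hre.trans_eq (by rw [hD]; ring)
  have hm : 1 + η ≤ u x₀ := by linarith
  nlinarith [mul_nonneg (by linarith : 0 ≤ u x₀ - 1) (by nlinarith : 0 ≤ u x₀ ^ 2 - 1)]

end MaximumPrinciple

/-- Brezis-type theorem for the fractional Ginzburg–Landau equation. -/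
theorem stmt4 (n : ℕ) (hn : 1 ≤ n) (α C : ℝ) (hα : 0 < α) (hα2 : α < 2) (hC : 0 < C)
    (u : EuclideanSpace ℝ (Fin n) → ℝ) (hu : MemE n α u)
    (heq : ∀ x, fracLap n α C u x = u x * (1 - |u x| ^ 2))
    (hint : Integrable (fun x : EuclideanSpace ℝ (Fin n) => (1 - |u x| ^ 2) ^ 2)) :
    ∀ x, |u x| ≤ 1 := by
  have hc : Continuous u := hu.1.continuous
  have hs : (n : ℝ) < n + α := by linarith
  have hs2 : (n : ℝ) + α < n + 2 := by linarith
  have hsol : SolvesGL ((n : ℝ) + α) C u := fun x => by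
    obtain ⟨L, hL⟩ := exists_tendsto_truncLap hs hint hc hn hs2 hu.1 hu.2.1 x
    exact ⟨L, hL, by rw [← fracLap_eq_of_tendsto hL, heq, sq_abs]⟩
  intro x
  refine abs_le'.2 ⟨le_one_of_solvesGL hn hs hs2 hC hc hint hsol x,
    le_one_of_solvesGL hn hs hs2 hC hc.neg ?_ hsol.neg x⟩
  rw [potential_neg]
  exact hint
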